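/- For integers 1 ≤ k ≤ n, the following polynomial identity holds in ℤ[x]: Σ_{I ⊆ {1,…,k}} binom(n, ΔI) · x^{|I|} = 1 + x · Σ_{j=0}^{k−1} binom(n, j) · A_j(x) · (1 + x + … + x^{k−1−j}), where A_j(x) = Σ_{w ∈ S_j} x^{des(w)} is the j-th Eulerian polynomial (A_0(x) = 1). (Both sides equal the augmented Chow polynomial of the uniform matroid U_{k,n}.) -/

import Mathlib

open Finset Polynomial

/-- Differences list: `diffList N prev [m₁,…,m_s] = [m₁ - prev, m₂ - m₁, …, N - m_s]`. -/
def diffList (N : ℕ) : ℕ → List ℕ → List ℕ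
  | prev, [] => [N - prev]
  | prev, m :: ms => (m - prev) :: diffList N m ms

/-- The minima of the maximal blocks of consecutive integers of `I`, listed increasingly. -/
def blockMinima (I : Finset ℕ) : List ℕ :=
  (I.filter fun i => i - 1 ∉ I).sort (· ≤ ·)

/-- The multinomial coefficient `binom(n, ΔI)`:
for `I` with block minima `m₁ < … < m_s` this is
`n! / ((m₁-1)! (m₂-m₁)! ⋯ (m_s-m_{s-1})! (n-m_s+1)!)`, and `1` for `I = ∅`. -/
def binomDelta (n : ℕ) (I : Finset ℕ) : ℕ :=
  n.factorial / ((diffList (n + 1) 1 (blockMinima I)).map Nat.factorial).prod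

/-- One-line notation: `oneline n w i = w(i)` for `i ∈ {1,…,n}`, with values in `{1,…,n}`. -/
def oneline (n : ℕ) (w : Equiv.Perm (Fin n)) (i : ℕ) : ℕ :=
  if h : i - 1 < n then (w ⟨i - 1, h⟩ : ℕ) + 1 else 0

/-- The descent set `Des(w) ⊆ {1,…,n-1}` of a permutation `w` of `{1,…,n}`:
positions `i` with `w(i) > w(i+1)`. -/
def descSet (n : ℕ) (w : Equiv.Perm (Fin n)) : Finset ℕ :=
  (Finset.Ico 1 n).filter fun i => oneline n w (i + 1) < oneline n w i

/-- `E(n, D)`: the number of permutations of `{1,…,n}` with descent set exactly `D`. -/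
def eulerianCount (n : ℕ) (D : Finset ℕ) : ℕ :=
  (Finset.univ.filter fun w : Equiv.Perm (Fin n) => descSet n w = D).card

/-- The `j`-th Eulerian polynomial `A_j(x) = Σ_{w ∈ S_j} x^{des w}`. -/
noncomputable def eulerianPoly (j : ℕ) : Polynomial ℤ :=
  ∑ w ∈ (Finset.univ : Finset (Equiv.Perm (Fin j))), X ^ (descSet j w).card

/-! ### Descents and the first letter of a permutation -/

/-- The permutation of `Fin (n + 1)` with first value `a` whose remaining values are in the same
relative order as those of `w`. -/
def consPerm {n : ℕ} (a : Fin (n + 1)) (w : Equiv.Perm (Fin n)) : Equiv.Perm (Fin (n + 1)) :=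
  (finSuccEquiv' 0).trans ((Equiv.optionCongr w).trans (finSuccEquiv' a).symm)

@[simp] lemma consPerm_zero {n : ℕ} (a : Fin (n + 1)) (w : Equiv.Perm (Fin n)) :
    consPerm a w 0 = a := by
  simp [consPerm]

@[simp] lemma consPerm_succ {n : ℕ} (a : Fin (n + 1)) (w : Equiv.Perm (Fin n)) (i : Fin n) :
    consPerm a w i.succ = a.succAbove (w i) := by
  rw [← Fin.succAbove_zero, consPerm, Equiv.trans_apply, finSuccEquiv'_succAbove]
  simp

lemma consPerm_bijective (n : ℕ) :
    Function.Bijective fun p : Fin (n + 1) × Equiv.Perm (Fin n) => consPerm p.1 p.2 := by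
  rw [Fintype.bijective_iff_injective_and_card]
  constructor
  · rintro ⟨a, w⟩ ⟨b, v⟩ h
    have hab : a = b := by simpa using DFunLike.congr_fun h 0
    subst hab
    refine Prod.ext rfl (Equiv.ext fun i => ?_)
    simpa using DFunLike.congr_fun h i.succ
  · simp [Fintype.card_perm, Nat.factorial_succ]

lemma sum_perm_succ {M : Type*} [AddCommMonoid M] (n : ℕ)
    (f : Equiv.Perm (Fin (n + 1)) → M) :
    ∑ w, f w = ∑ a : Fin (n + 1), ∑ w : Equiv.Perm (Fin n), f (consPerm a w) := by
  rw [← Fintype.sum_prod_type', ← (consPerm_bijective n).sum_comp f]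

lemma card_descSet_succ (n : ℕ) (w : Equiv.Perm (Fin (n + 1))) :
    (descSet (n + 1) w).card = ∑ i : Fin n, if w i.succ < w i.castSucc then 1 else 0 := by
  rw [descSet, Finset.card_filter, Finset.sum_Ico_eq_sum_range, ← Fin.sum_univ_eq_sum_range
    (fun i => if oneline (n + 1) w (1 + i + 1) < oneline (n + 1) w (1 + i) then 1 else 0)]
  refine Finset.sum_congr rfl fun i _ => ?_
  have h1 : oneline (n + 1) w (1 + i + 1) = w i.succ + 1 := by
    have : 1 + (i : ℕ) + 1 - 1 < n + 1 := by omega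
    rw [oneline, dif_pos this,
      show (⟨_, this⟩ : Fin (n + 1)) = i.succ from Fin.ext (by simp; omega)]
  have h2 : oneline (n + 1) w (1 + i) = w i.castSucc + 1 := by
    have : 1 + (i : ℕ) - 1 < n + 1 := by omega
    rw [oneline, dif_pos this,
      show (⟨_, this⟩ : Fin (n + 1)) = i.castSucc from
        Fin.ext (by simp)]
  rw [h1, h2]
  simp only [add_lt_add_iff_right, Fin.lt_def]

lemma card_descSet_consPerm (n : ℕ) (a : Fin (n + 2)) (w : Equiv.Perm (Fin (n + 1))) :
    (descSet (n + 2) (consPerm a w)).card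
      = (if (w 0 : ℕ) < a then 1 else 0) + (descSet (n + 1) w).card := by
  rw [card_descSet_succ, card_descSet_succ, Fin.sum_univ_succ]
  congr 1
  · have : a.succAbove (w 0) < a ↔ (w 0 : ℕ) < a := by
      rw [Fin.succAbove_lt_iff_castSucc_lt, Fin.lt_def, Fin.val_castSucc]
    simp only [Fin.castSucc_zero, consPerm_zero, consPerm_succ, this]
  · refine Finset.sum_congr rfl fun i _ => ?_
    rw [← Fin.succ_castSucc, consPerm_succ, consPerm_succ]
    simp [Fin.succAbove_lt_succAbove_iff]

/-- The descent generating polynomial of the permutations of `Fin (n + 1)` with first value `a`. -/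
noncomputable def eulerianFirst (n a : ℕ) : ℤ[X] :=
  ∑ w : Equiv.Perm (Fin (n + 1)), if (w 0 : ℕ) = a then X ^ (descSet (n + 1) w).card else 0

lemma eulerianFirst_succ (n a : ℕ) (ha : a < n + 2) :
    eulerianFirst (n + 1) a = ∑ w : Equiv.Perm (Fin (n + 1)),
      (if (w 0 : ℕ) < a then X else 1) * X ^ (descSet (n + 1) w).card := by
  rw [eulerianFirst, sum_perm_succ, Finset.sum_eq_single ⟨a, ha⟩]
  · refine Finset.sum_congr rfl fun w _ => ?_
    rw [card_descSet_consPerm, pow_add]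
    simp
  · intro b _ hb
    have : (b : ℕ) ≠ a := fun h => hb (Fin.ext h)
    simp [this]
  · simp

lemma eulerianFirst_succ_zero (n : ℕ) : eulerianFirst (n + 1) 0 = eulerianPoly (n + 1) := by
  rw [eulerianFirst_succ n 0 (by omega)]
  simp [eulerianPoly]

lemma eulerianFirst_succ_last (n : ℕ) :
    eulerianFirst (n + 1) (n + 1) = X * eulerianPoly (n + 1) := by
  rw [eulerianFirst_succ n (n + 1) (by omega), eulerianPoly, Finset.mul_sum]
  refine Finset.sum_congr rfl fun w _ => ?_
  rw [if_pos (w 0).isLt]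

lemma eulerianFirst_succ_succ (n a : ℕ) (ha : a ≤ n) :
    eulerianFirst (n + 1) (a + 1)
      = eulerianFirst (n + 1) a + (X - 1) * eulerianFirst n a := by
  rw [eulerianFirst_succ n (a + 1) (by omega), eulerianFirst_succ n a (by omega), eulerianFirst,
    Finset.mul_sum, ← Finset.sum_add_distrib]
  refine Finset.sum_congr rfl fun w _ => ?_
  rcases lt_trichotomy (w 0 : ℕ) a with h | h | h
  · simp [h, h.ne, h.trans (Nat.lt_succ_self a)]
  · simp only [h, lt_add_iff_pos_right, zero_lt_one, if_true, lt_irrefl, if_false]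
    ring
  · simp [h.ne', h.not_gt, show ¬ (w 0 : ℕ) < a + 1 by omega]

@[simp] lemma eulerianPoly_zero : eulerianPoly 0 = 1 := by
  simp [eulerianPoly, descSet]

lemma eulerianFirst_zero_zero : eulerianFirst 0 0 = 1 := by
  simp [eulerianFirst, descSet]

/-! ### The umbral functional of the Eulerian polynomials -/

/-- The `ℤ[X]`-linear functional on `ℤ[X][X]` sending the `j`-th power of the outer variable to the
`j`-th Eulerian polynomial. -/
noncomputable def eulerianFunctional : ℤ[X][X] →ₗ[ℤ[X]] ℤ[X] :=
  (Polynomial.basisMonomials ℤ[X]).constr ℤ[X] eulerianPoly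

@[simp] lemma eulerianFunctional_X_pow (j : ℕ) : eulerianFunctional (X ^ j) = eulerianPoly j := by
  have := (Polynomial.basisMonomials ℤ[X]).constr_basis ℤ[X] eulerianPoly j
  rw [Polynomial.coe_basisMonomials] at this
  rwa [← show (monomial j : ℤ[X] →ₗ[ℤ[X]] _) 1 = X ^ j from
    monomial_one_right_eq_X_pow j]

lemma eulerianFunctional_C_mul (c : ℤ[X]) (p : ℤ[X][X]) :
    eulerianFunctional (C c * p) = c * eulerianFunctional p := by
  rw [← smul_eq_C_mul, map_smul, smul_eq_mul]

lemma eulerianFirst_eq_eulerianFunctional (n a : ℕ) (ha : a ≤ n) :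
    eulerianFirst n a = eulerianFunctional (X ^ (n - a) * (X + C (X - 1)) ^ a) := by
  induction n generalizing a with
  | zero =>
    obtain rfl : a = 0 := by omega
    have := eulerianFunctional_X_pow 0
    simp_all [eulerianFirst_zero_zero]
  | succ n ih =>
    induction a with
    | zero => simp [eulerianFirst_succ_zero]
    | succ a iha =>
      rw [eulerianFirst_succ_succ n a (by omega), iha (by omega), ih a (by omega),
        ← eulerianFunctional_C_mul, ← map_add, Nat.succ_sub (show a ≤ n by omega),
        Nat.succ_sub_succ, pow_succ]
      congr 1
      ring

lemma eulerianFunctional_taylor (p : ℤ[X][X]) :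
    eulerianFunctional (taylor (X - 1) p) = X * eulerianFunctional p + (1 - X) * p.eval 0 := by
  have h : eulerianFunctional ∘ₗ taylor (X - 1 : ℤ[X])
      = (X : ℤ[X]) • eulerianFunctional + (1 - X : ℤ[X]) • leval 0 := by
    refine Polynomial.lhom_ext' fun n => LinearMap.ext_ring ?_
    have key := eulerianFirst_eq_eulerianFunctional n n le_rfl
    rcases n with _ | n
    · have h1 : eulerianFunctional 1 = 1 := by simpa using eulerianFunctional_X_pow 0
      simp [h1]
    · rw [eulerianFirst_succ_last] at key
      simp_all [monomial_one_right_eq_X_pow]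
  simpa using LinearMap.congr_fun h p

lemma sum_choose_mul_eulerianPoly (n : ℕ) :
    ∑ j ∈ range (n + 1), (n.choose j : ℤ[X]) * eulerianPoly j * X ^ (n - j)
      = X * ∑ j ∈ range (n + 1), (n.choose j : ℤ[X]) * eulerianPoly j + (1 - X) := by
  have expand (c : ℤ[X]) : eulerianFunctional ((X + C c) ^ n)
      = ∑ j ∈ range (n + 1), (n.choose j : ℤ[X]) * eulerianPoly j * c ^ (n - j) := by
    rw [add_pow, map_sum]
    refine Finset.sum_congr rfl fun j _ => ?_
    rw [← C_pow, ← C_eq_natCast, mul_assoc, ← C_mul, mul_comm, eulerianFunctional_C_mul,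
      eulerianFunctional_X_pow]
    ring
  have h := eulerianFunctional_taylor ((X + C 1) ^ n)
  rw [taylor_pow, map_add, taylor_X, taylor_C, add_assoc, ← C_add, sub_add_cancel, expand,
    expand] at h
  simpa using h

lemma eulerianPoly_eq_sum (n : ℕ) (hn : 1 ≤ n) :
    eulerianPoly n = 1 + X * ∑ j ∈ range (n - 1), (n.choose j : ℤ[X]) * eulerianPoly j
        * ∑ t ∈ range (n - 1 - j), X ^ t := by
  obtain ⟨n, rfl⟩ : ∃ m, n = m + 1 := ⟨n - 1, by omega⟩
  have h := sum_choose_mul_eulerianPoly (n + 1)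
  rw [Finset.sum_range_succ, Finset.sum_range_succ, Finset.sum_range_succ (n := n + 1),
    Finset.sum_range_succ (n := n)] at h
  refine mul_left_cancel₀ (X_sub_C_ne_zero (1 : ℤ)) ?_
  have geom : (X - C 1) * ∑ j ∈ range n, ((n + 1).choose j : ℤ[X]) * eulerianPoly j
        * ∑ t ∈ range (n - j), (X : ℤ[X]) ^ t
      = ∑ j ∈ range n, ((n + 1).choose j : ℤ[X]) * eulerianPoly j * (X ^ (n - j) - 1) := by
    rw [Finset.mul_sum]
    refine Finset.sum_congr rfl fun j _ => ?_
    rw [← geom_sum_mul, C_1]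
    ring
  have geom' : X * ∑ j ∈ range n, ((n + 1).choose j : ℤ[X]) * eulerianPoly j * (X ^ (n - j) - 1)
      = ∑ j ∈ range n, ((n + 1).choose j : ℤ[X]) * eulerianPoly j * X ^ (n + 1 - j)
        - X * ∑ j ∈ range n, ((n + 1).choose j : ℤ[X]) * eulerianPoly j := by
    rw [Finset.mul_sum, Finset.mul_sum, ← Finset.sum_sub_distrib]
    refine Finset.sum_congr rfl fun j hj => ?_
    rw [Nat.succ_sub (Finset.mem_range.1 hj).le, pow_succ]
    ring
  simp only [Nat.add_sub_cancel, Nat.choose_self, Nat.cast_one, Nat.sub_self,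
    Nat.add_sub_cancel_left, pow_zero, pow_one] at h ⊢
  rw [mul_add, mul_left_comm, geom, geom', C_1]
  linear_combination -h

/-! ### Block minima and multinomial coefficients -/

lemma diffList_append (N k prev : ℕ) (l : List ℕ) :
    diffList N prev (l ++ [k]) = diffList k prev l ++ [N - k] := by
  induction l generalizing prev with
  | nil => rfl
  | cons m l ih => simp [diffList, ih]

lemma prod_factorial_diffList_dvd (N prev : ℕ) (l : List ℕ) (hl : (prev :: l).Pairwise (· ≤ ·))
    (hN : ∀ m ∈ prev :: l, m ≤ N) :
    ((diffList N prev l).map Nat.factorial).prod ∣ (N - prev).factorial := by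
  induction l generalizing prev with
  | nil => simp [diffList]
  | cons m l ih =>
    have h1 : prev ≤ m := List.rel_of_pairwise_cons hl (by simp)
    have h2 : m ≤ N := hN m (by simp)
    have h3 := Nat.factorial_mul_factorial_dvd_factorial_add (m - prev) (N - m)
    rw [show m - prev + (N - m) = N - prev by omega] at h3
    simp only [diffList, List.map_cons, List.prod_cons]
    exact (mul_dvd_mul_left _ (ih m hl.of_cons fun x hx => hN x (by simp_all))).trans h3

lemma blockMinima_insert_of_gap (k : ℕ) (I : Finset ℕ) (hI : ∀ i ∈ I, i < k) :
    blockMinima (insert (k + 1) I) = blockMinima I ++ [k + 1] := by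
  have hf : (insert (k + 1) I).filter (fun i => i - 1 ∉ insert (k + 1) I)
      = insert (k + 1) (I.filter fun i => i - 1 ∉ I) := by
    ext i
    have := hI i
    have := hI k
    simp only [mem_filter, mem_insert]
    grind
  have hnot : k + 1 ∉ I.filter fun i => i - 1 ∉ I := by
    intro h
    have := hI _ (mem_filter.1 h).1
    omega
  refine List.Perm.eq_of_pairwise (le := (· ≤ ·)) (fun a b _ _ => le_antisymm)
    (Finset.pairwise_sort _ _) ?_ ?_
  · rw [List.pairwise_append]
    refine ⟨Finset.pairwise_sort _ _, by simp, fun a ha b hb => ?_⟩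
    rw [blockMinima, Finset.mem_sort, mem_filter] at ha
    have := hI a ha.1
    simp only [List.mem_singleton] at hb
    omega
  · refine (List.perm_ext_iff_of_nodup (Finset.sort_nodup _ _) ?_).2 fun a => ?_
    rotate_left
    · rw [List.mem_append, blockMinima, Finset.mem_sort, hf, mem_insert,
        Finset.mem_sort, List.mem_singleton, or_comm]
    · rw [List.nodup_append]
      refine ⟨Finset.sort_nodup _ _, by simp, fun a ha b hb => ?_⟩
      rw [blockMinima, Finset.mem_sort] at ha
      rintro rfl
      simp_all

lemma binomDelta_insert_of_gap (n k : ℕ) (hk : k ≤ n) (I : Finset ℕ)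
    (hI : ∀ i ∈ I, 1 ≤ i ∧ i < k) :
    binomDelta n (insert (k + 1) I) = n.choose k * binomDelta k I := by
  have hdvd : ((diffList (k + 1) 1 (blockMinima I)).map Nat.factorial).prod ∣ k.factorial := by
    have hmem : ∀ m ∈ blockMinima I, 1 ≤ m ∧ m < k := fun m hm => by
      rw [blockMinima, Finset.mem_sort, mem_filter] at hm
      exact hI m hm.1
    refine prod_factorial_diffList_dvd (k + 1) 1 (blockMinima I) ?_ ?_
    · exact List.pairwise_cons.2 ⟨fun m hm => (hmem m hm).1, Finset.pairwise_sort _ _⟩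
    · intro m hm
      rcases List.mem_cons.1 hm with rfl | hm
      · omega
      · have := hmem m hm
        omega
  rw [binomDelta, binomDelta, blockMinima_insert_of_gap k I fun i hi => (hI i hi).2,
    diffList_append, ← Nat.choose_mul_factorial_mul_factorial hk, List.map_append,
    List.prod_append, ← Nat.mul_div_assoc _ hdvd]
  simp only [Nat.add_sub_add_right, List.map_cons, List.map_nil, List.prod_singleton]
  exact Nat.mul_div_mul_right _ _ (Nat.factorial_pos _)

lemma binomDelta_insert_insert (n k : ℕ) (I : Finset ℕ) (hI : ∀ i ∈ I, i ≤ k) :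
    binomDelta n (insert (k + 2) (insert (k + 1) I)) = binomDelta n (insert (k + 1) I) := by
  have h : blockMinima (insert (k + 2) (insert (k + 1) I)) = blockMinima (insert (k + 1) I) := by
    rw [blockMinima, blockMinima]
    congr 1
    ext i
    have := hI i
    have := hI (i - 1)
    simp only [mem_filter, mem_insert]
    grind
  rw [binomDelta, binomDelta, h]

/-! ### The recursion for the left-hand side -/

/-- The generating polynomial `∑_{I ⊆ [k]} binom(n, ΔI) x^{|I|}`. -/
noncomputable def binomDeltaPoly (n k : ℕ) : ℤ[X] :=
  ∑ I ∈ (Finset.Icc 1 k).powerset, (binomDelta n I : ℤ[X]) * X ^ I.card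

/-- The part of `binomDeltaPoly n (k + 1)` coming from the sets that contain `k + 1`. -/
noncomputable def binomDeltaPolyTop (n k : ℕ) : ℤ[X] :=
  ∑ I ∈ (Finset.Icc 1 k).powerset,
    (binomDelta n (insert (k + 1) I) : ℤ[X]) * X ^ (insert (k + 1) I).card

lemma binomDeltaPoly_zero (n : ℕ) : binomDeltaPoly n 0 = 1 := by
  simp [binomDeltaPoly, binomDelta, blockMinima, diffList, Nat.div_self (Nat.factorial_pos n)]

lemma binomDeltaPoly_succ (n k : ℕ) :
    binomDeltaPoly n (k + 1) = binomDeltaPoly n k + binomDeltaPolyTop n k := by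
  rw [binomDeltaPoly, ← Finset.insert_Icc_right_eq_Icc_add_one (by omega),
    Finset.sum_powerset_insert (by simp)]
  rfl

lemma sum_powerset_gap (n k : ℕ) (hk : k ≤ n) :
    ∑ I ∈ (Finset.Icc 1 (k - 1)).powerset,
      (binomDelta n (insert (k + 1) I) : ℤ[X]) * X ^ (insert (k + 1) I).card
      = X * ((n.choose k : ℤ[X]) * binomDeltaPoly k (k - 1)) := by
  rw [binomDeltaPoly, Finset.mul_sum, Finset.mul_sum]
  refine Finset.sum_congr rfl fun I hI => ?_
  have hI' : ∀ i ∈ I, 1 ≤ i ∧ i < k := fun i hi => by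
    have := Finset.mem_Icc.1 (Finset.mem_powerset.1 hI hi)
    omega
  have hnot : k + 1 ∉ I := fun h => by
    have := hI' _ h
    omega
  rw [binomDelta_insert_of_gap n k hk I hI', Finset.card_insert_of_notMem hnot]
  push_cast
  ring

lemma binomDeltaPolyTop_zero (n : ℕ) : binomDeltaPolyTop n 0 = X := by
  have := sum_powerset_gap n 0 (Nat.zero_le n)
  simpa [binomDeltaPolyTop, binomDeltaPoly_zero] using this

lemma binomDeltaPolyTop_succ (n k : ℕ) (hk : k + 1 ≤ n) :
    binomDeltaPolyTop n (k + 1) = X * ((n.choose (k + 1) : ℤ[X]) * binomDeltaPoly (k + 1) k)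
      + X * binomDeltaPolyTop n k := by
  rw [binomDeltaPolyTop, ← Finset.insert_Icc_right_eq_Icc_add_one (by omega),
    Finset.sum_powerset_insert (by simp)]
  congr 1
  · exact sum_powerset_gap n (k + 1) hk
  · rw [binomDeltaPolyTop, Finset.mul_sum]
    refine Finset.sum_congr rfl fun I hI => ?_
    have hI' : ∀ i ∈ I, i ≤ k := fun i hi =>
      (Finset.mem_Icc.1 (Finset.mem_powerset.1 hI hi)).2
    have hnot : k + 2 ∉ insert (k + 1) I := fun h => by
      rcases Finset.mem_insert.1 h with h | h
      · omega
      · have := hI' _ h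
        omega
    rw [binomDelta_insert_insert n k I hI', Finset.card_insert_of_notMem hnot]
    ring

lemma binomDeltaPolyTop_eq (n k : ℕ) (hk : k ≤ n) :
    binomDeltaPolyTop n k = X * ∑ j ∈ range (k + 1),
      (n.choose j : ℤ[X]) * binomDeltaPoly j (j - 1) * X ^ (k - j) := by
  induction k with
  | zero => simp [binomDeltaPolyTop_zero, binomDeltaPoly_zero]
  | succ k ih =>
    rw [binomDeltaPolyTop_succ n k hk, ih (by omega), Finset.sum_range_succ _ (k + 1), mul_add,
      add_comm, Finset.mul_sum (range (k + 1)) _ X, Finset.mul_sum (range (k + 1)) _ X]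
    simp only [Nat.sub_self, pow_zero, mul_one, Nat.add_sub_cancel]
    rw [Finset.mul_sum]
    congr 1
    refine Finset.sum_congr rfl fun j hj => ?_
    rw [Nat.succ_sub (Nat.lt_succ_iff.1 (Finset.mem_range.1 hj)), pow_succ]
    ring

lemma binomDeltaPoly_eq (n k : ℕ) (hk : k ≤ n) :
    binomDeltaPoly n k = 1 + X * ∑ j ∈ range k,
      (n.choose j : ℤ[X]) * binomDeltaPoly j (j - 1) * ∑ t ∈ range (k - j), X ^ t := by
  induction k with
  | zero => simp [binomDeltaPoly_zero]
  | succ k ih =>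
    rw [binomDeltaPoly_succ, ih (by omega), binomDeltaPolyTop_eq n k (by omega), add_assoc,
      ← mul_add, Finset.sum_range_succ, Finset.sum_range_succ, ← add_assoc,
      ← Finset.sum_add_distrib]
    congr 2
    simp only [Nat.sub_self, pow_zero, Nat.add_sub_cancel_left, Finset.sum_range_one]
    congr 1
    refine Finset.sum_congr rfl fun j hj => ?_
    rw [Nat.succ_sub (Finset.mem_range.1 hj).le, Finset.sum_range_succ, mul_add]

lemma binomDeltaPoly_pred (n : ℕ) : binomDeltaPoly n (n - 1) = eulerianPoly n := by
  induction n using Nat.strong_induction_on with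
  | _ n ih =>
    rcases Nat.eq_zero_or_pos n with rfl | hn
    · simp [binomDeltaPoly_zero]
    · rw [binomDeltaPoly_eq n (n - 1) (by omega), eulerianPoly_eq_sum n hn]
      refine congrArg (fun p => 1 + X * p) (Finset.sum_congr rfl fun j hj => ?_)
      rw [ih j (by have := Finset.mem_range.1 hj; omega)]

/-- For `1 ≤ k ≤ n`, in `ℤ[x]`:
`Σ_{I ⊆ {1,…,k}} binom(n, ΔI) x^{|I|}
  = 1 + x · Σ_{j=0}^{k-1} binom(n,j) A_j(x) (1 + x + ⋯ + x^{k-1-j})`. -/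
theorem augChow_uniform_eq_sum_eulerian (n k : ℕ) (hk : 1 ≤ k) (hkn : k ≤ n) :
    ∑ I ∈ (Finset.Icc 1 k).powerset,
      (binomDelta n I : Polynomial ℤ) * X ^ I.card
    = 1 + X * ∑ j ∈ Finset.range k,
        (n.choose j : Polynomial ℤ) * eulerianPoly j
          * ∑ t ∈ Finset.range (k - j), X ^ t := by
  have h := binomDeltaPoly_eq n k hkn
  simp only [binomDeltaPoly_pred] at h
  exact h
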